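/- arXiv:2303.02645 — 11 statements merged into one kernel-verified Lean document; each statement's English description precedes it below -/
import Mathlib

section
/- Fix a family of nested opportunity sets (Λ, p̃) for income y, an alternative k ∈ C and a price p_k ∈ ℝ. Then for every preference type ω, the set S_ω := {λ ∈ Λ | ∀ c ∈ C, U ω k (y − p_k) ≥ U ω c (y − p̃ c λ)} is nonempty, bounded above, and closed in ℝ; consequently sSup S_ω ∈ S_ω, i.e. the supremum defining the NOS welfare measure W ω is attained. -/
open MeasureTheory
open scoped ENNReal BigOperators

/-- `i` is weakly optimal for type `ω` at price vector `p` and income `y`: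
its utility is weakly largest among all alternatives. -/
def WeakOpt {Ω : Type*} {n : ℕ} (U : Ω → Fin n → ℝ → ℝ) (ω : Ω)
    (p : Fin n → ℝ) (y : ℝ) (i : Fin n) : Prop :=
  ∀ c, U ω c (y - p c) ≤ U ω i (y - p i)

/-- Choice probability `P_i(p, y)`. -/
noncomputable def ChoiceProb {Ω : Type*} [MeasurableSpace Ω] {n : ℕ}
    (μ : Measure Ω) (U : Ω → Fin n → ℝ → ℝ) (p : Fin n → ℝ) (y : ℝ) (i : Fin n) : ℝ≥0∞ :=
  μ {ω | WeakOpt U ω p y i}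

/-- Transition probability `P_{i,j}(p, p', y)`. -/
noncomputable def TransProb {Ω : Type*} [MeasurableSpace Ω] {n : ℕ}
    (μ : Measure Ω) (U : Ω → Fin n → ℝ → ℝ) (p p' : Fin n → ℝ) (y : ℝ) (i j : Fin n) : ℝ≥0∞ :=
  μ {ω | WeakOpt U ω p y i ∧ WeakOpt U ω p' y j}

/-- Regularity condition (R1): for every type, every pair of alternatives and every
residual numeraire level, sufficiently poor levels at `c'` are worse and sufficiently
rich levels at `c'` are better. -/
def Reg1 {Ω : Type*} {n : ℕ} (U : Ω → Fin n → ℝ → ℝ) : Prop :=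
  ∀ (ω : Ω) (c c' : Fin n) (m : ℝ),
    (∃ m₀ : ℝ, ∀ m' ≤ m₀, U ω c' m' < U ω c m) ∧
    (∃ m₁ : ℝ, ∀ m', m₁ ≤ m' → U ω c m < U ω c' m')

/-- Negligible ties (R2): at any price vector and income, the set of types indifferent
between two distinct alternatives has measure zero. -/
def Reg2 {Ω : Type*} [MeasurableSpace Ω] {n : ℕ} (μ : Measure Ω)
    (U : Ω → Fin n → ℝ → ℝ) : Prop :=
  ∀ (q : Fin n → ℝ) (y : ℝ) (c c' : Fin n), c ≠ c' →
    μ {ω | U ω c (y - q c) = U ω c' (y - q c')} = 0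

/-- A family of nested opportunity sets, described by an index set `Λ ⊆ ℝ`
and virtual prices `ptilde`. -/
structure NOSFamily {n : ℕ} (Λ : Set ℝ) (ptilde : ℝ → Fin n → ℝ) : Prop where
  nonempty : Λ.Nonempty
  closed : IsClosed Λ
  cont : ∀ c : Fin n, ContinuousOn (fun l => ptilde l c) Λ
  anti : ∀ l ∈ Λ, ∀ l' ∈ Λ, l < l' →
    (∀ c, ptilde l' c ≤ ptilde l c) ∧ ∃ c, ptilde l' c < ptilde l c
  unbddAbove : ∀ (c : Fin n) (M : ℝ), ∃ l ∈ Λ, M ≤ ptilde l c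
  unbddBelow : ∃ c : Fin n, ∀ M : ℝ, ∃ l ∈ Λ, ptilde l c ≤ M

/-- The NOS welfare measure of type `ω` at alternative `k` with price `pk`. -/
noncomputable def NOSWelfare {Ω : Type*} {n : ℕ} (U : Ω → Fin n → ℝ → ℝ)
    (Λ : Set ℝ) (ptilde : ℝ → Fin n → ℝ) (y : ℝ) (k : Fin n) (pk : ℝ) (ω : Ω) : ℝ :=
  sSup {l | l ∈ Λ ∧ ∀ c, U ω c (y - ptilde l c) ≤ U ω k (y - pk)}

/-- The money-metric utility of type `ω` at alternative `k` with price `pk`,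
income `y` and reference prices `r`. -/
noncomputable def MMU {Ω : Type*} {n : ℕ} (U : Ω → Fin n → ℝ → ℝ)
    (r : Fin n → ℝ) (y : ℝ) (k : Fin n) (pk : ℝ) (ω : Ω) : ℝ :=
  sSup {l : ℝ | ∀ c, U ω c (l - r c) ≤ U ω k (y - pk)}

/-- `CV` is a compensating variation for the price change from `p` to `p'` at income `y`. -/
def IsCV {Ω : Type*} {n : ℕ} (U : Ω → Fin n → ℝ → ℝ)
    (p p' : Fin n → ℝ) (y : ℝ) (CV : Ω → ℝ) : Prop :=
  ∀ ω, (⨆ c, U ω c (y - p c)) = ⨆ c, U ω c (y - p' c - CV ω)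

/-- `EV` is an equivalent variation for the price change from `p` to `p'` at income `y`. -/
def IsEV {Ω : Type*} {n : ℕ} (U : Ω → Fin n → ℝ → ℝ)
    (p p' : Fin n → ℝ) (y : ℝ) (EV : Ω → ℝ) : Prop :=
  ∀ ω, (⨆ c, U ω c (y - p c - EV ω)) = ⨆ c, U ω c (y - p' c)

/-- the set defining the NOS welfare measure is nonempty, bounded above
and closed, so its supremum is attained. -/
theorem nos_welfare_attained {Ω : Type*} [MeasurableSpace Ω] {n : ℕ} (hn : 0 < n)
    (μ : Measure Ω) [IsProbabilityMeasure μ]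
    (U : Ω → Fin n → ℝ → ℝ)
    (hCont : ∀ ω c, Continuous (U ω c))
    (hMono : ∀ ω c, StrictMono (U ω c))
    (hR1 : Reg1 U)
    (Λ : Set ℝ) (ptilde : ℝ → Fin n → ℝ) (hFam : NOSFamily Λ ptilde)
    (y : ℝ) (k : Fin n) (pk : ℝ) (ω : Ω) :
    ({l | l ∈ Λ ∧ ∀ c, U ω c (y - ptilde l c) ≤ U ω k (y - pk)} : Set ℝ).Nonempty ∧
    BddAbove {l | l ∈ Λ ∧ ∀ c, U ω c (y - ptilde l c) ≤ U ω k (y - pk)} ∧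
    IsClosed {l | l ∈ Λ ∧ ∀ c, U ω c (y - ptilde l c) ≤ U ω k (y - pk)} ∧
    sSup {l | l ∈ Λ ∧ ∀ c, U ω c (y - ptilde l c) ≤ U ω k (y - pk)} ∈
      {l | l ∈ Λ ∧ ∀ c, U ω c (y - ptilde l c) ≤ U ω k (y - pk)} := by
  have hanti : ∀ l ∈ Λ, ∀ l' ∈ Λ, l ≤ l' → ∀ c, ptilde l' c ≤ ptilde l c := by
    intro l hl l' hl' h c
    rcases h.eq_or_lt with rfl | h
    · exact le_rfl
    · exact (hFam.anti l hl l' hl' h).1 c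
  have hne : {l | l ∈ Λ ∧ ∀ c, U ω c (y - ptilde l c) ≤ U ω k (y - pk)}.Nonempty := by
    have hex : ∀ c, ∃ l ∈ Λ, U ω c (y - ptilde l c) ≤ U ω k (y - pk) := by
      intro c
      obtain ⟨m₀, hm₀⟩ := (hR1 ω k c (y - pk)).1
      obtain ⟨l, hl, hM⟩ := hFam.unbddAbove c (y - m₀)
      exact ⟨l, hl, (hm₀ _ (by linarith)).le⟩
    choose L hL hU using hex
    have : Nonempty (Fin n) := ⟨k⟩
    obtain ⟨c₀, hc₀⟩ := Finite.exists_min L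
    refine ⟨L c₀, hL c₀, fun c => ((hMono ω c).monotone ?_).trans (hU c)⟩
    exact sub_le_sub_left (hanti _ (hL c₀) _ (hL c) (hc₀ c) c) y
  have hbdd : BddAbove {l | l ∈ Λ ∧ ∀ c, U ω c (y - ptilde l c) ≤ U ω k (y - pk)} := by
    obtain ⟨c, hc⟩ := hFam.unbddBelow
    obtain ⟨m₁, hm₁⟩ := (hR1 ω k c (y - pk)).2
    obtain ⟨b, hb, hM⟩ := hc (y - m₁)
    refine ⟨b, fun l hl => ?_⟩
    by_contra! hlt
    have hle := hanti b hb l hl.1 hlt.le c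
    exact (hm₁ (y - ptilde l c) (by linarith)).not_ge (hl.2 c)
  have hclosed : IsClosed {l | l ∈ Λ ∧ ∀ c, U ω c (y - ptilde l c) ≤ U ω k (y - pk)} := by
    have hcont : ContinuousOn (fun l c => U ω c (y - ptilde l c)) Λ :=
      continuousOn_pi.2 fun c =>
        (hCont ω c).comp_continuousOn (continuousOn_const.sub (hFam.cont c))
    exact hcont.preimage_isClosed_of_isClosed hFam.closed
      (isClosed_Iic (a := fun _ : Fin n => U ω k (y - pk)))
  exact ⟨hne, hbdd, hclosed, hclosed.csSup_mem hne hbdd⟩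
end

section
/- (Lemma 1, characterisation of NOS welfare.) Fix a family of nested opportunity sets (Λ, p̃) for income y, an alternative k ∈ C, a price p_k ∈ ℝ, and let W ω denote the NOS welfare measure of type ω at alternative k with price p_k. Then for every w ∈ Λ, {ω | w ≤ W ω} = {ω | ∀ c ∈ C, U ω k (y − p_k) ≥ U ω c (y − p̃ c w)}. -/
open MeasureTheory
open scoped ENNReal BigOperators

/-- Virtual prices are antitone along the family. -/
theorem NOSFamily.antitoneOn {n : ℕ} {Λ : Set ℝ} {ptilde : ℝ → Fin n → ℝ}
    (h : NOSFamily Λ ptilde) (c : Fin n) : AntitoneOn (fun l => ptilde l c) Λ := by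
  intro l hl l' hl' hll
  rcases hll.eq_or_lt with rfl | hlt
  · exact le_rfl
  · exact (h.anti l hl l' hl' hlt).1 c

/-- Some opportunity set in the family has all virtual prices above given bounds. -/
theorem NOSFamily.exists_forall_le {n : ℕ} {Λ : Set ℝ} {ptilde : ℝ → Fin n → ℝ}
    (h : NOSFamily Λ ptilde) (M : Fin n → ℝ) : ∃ l ∈ Λ, ∀ c, M c ≤ ptilde l c := by
  choose L hL hML using fun c => h.unbddAbove c (M c)
  obtain ⟨l₀, hl₀⟩ := h.nonempty
  rcases isEmpty_or_nonempty (Fin n) with hn | hn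
  · exact ⟨l₀, hl₀, fun c => hn.elim c⟩
  · obtain ⟨i, hi⟩ := Finite.exists_min L
    exact ⟨L i, hL i, fun c => (hML c).trans (h.antitoneOn c (hL i) (hL c) (hi c))⟩

/-- The set whose supremum defines the NOS welfare measure has a greatest element. -/
theorem isGreatest_NOSWelfare {Ω : Type*} {n : ℕ} {U : Ω → Fin n → ℝ → ℝ}
    (hCont : ∀ ω c, Continuous (U ω c)) (hR1 : Reg1 U)
    {Λ : Set ℝ} {ptilde : ℝ → Fin n → ℝ} (hFam : NOSFamily Λ ptilde)
    (y : ℝ) (k : Fin n) (pk : ℝ) (ω : Ω) :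
    IsGreatest {l | l ∈ Λ ∧ ∀ c, U ω c (y - ptilde l c) ≤ U ω k (y - pk)}
      (NOSWelfare U Λ ptilde y k pk ω) := by
  have hclosed : IsClosed {l | l ∈ Λ ∧ ∀ c, U ω c (y - ptilde l c) ≤ U ω k (y - pk)} := by
    have : Nonempty (Fin n) := ⟨k⟩
    have hc (c : Fin n) :
        IsClosed (Λ ∩ (fun l => U ω c (y - ptilde l c)) ⁻¹' Set.Iic (U ω k (y - pk))) :=
      ((hCont ω c).comp_continuousOn
        (continuousOn_const.sub (hFam.cont c))).preimage_isClosed_of_isClosed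
          hFam.closed isClosed_Iic
    convert isClosed_iInter hc using 1
    ext l
    simp [Set.mem_iInter, forall_and]
  have hne : {l | l ∈ Λ ∧ ∀ c, U ω c (y - ptilde l c) ≤ U ω k (y - pk)}.Nonempty := by
    choose m hm using fun c => (hR1 ω k c (y - pk)).1
    obtain ⟨l, hl, hml⟩ := hFam.exists_forall_le fun c => y - m c
    exact ⟨l, hl, fun c => (hm c _ (by linarith [hml c])).le⟩
  have hbdd : BddAbove {l | l ∈ Λ ∧ ∀ c, U ω c (y - ptilde l c) ≤ U ω k (y - pk)} := by
    obtain ⟨c, hc⟩ := hFam.unbddBelow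
    obtain ⟨m, hm⟩ := (hR1 ω k c (y - pk)).2
    obtain ⟨b, hb, hbm⟩ := hc (y - m)
    refine ⟨b, fun l hl => le_of_not_gt fun hbl => ?_⟩
    have hp : ptilde l c ≤ ptilde b c := hFam.antitoneOn c hb hl.1 hbl.le
    exact (hm (y - ptilde l c) (by linarith)).not_ge (hl.2 c)
  exact ⟨hclosed.csSup_mem hne hbdd, fun l hl => le_csSup hbdd hl⟩

/-- Lemma 1: characterisation of the NOS welfare measure. -/
theorem nos_welfare_characterisation {Ω : Type*} [MeasurableSpace Ω] {n : ℕ} (hn : 0 < n)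
    (μ : Measure Ω) [IsProbabilityMeasure μ]
    (U : Ω → Fin n → ℝ → ℝ)
    (hCont : ∀ ω c, Continuous (U ω c))
    (hMono : ∀ ω c, StrictMono (U ω c))
    (hR1 : Reg1 U)
    (Λ : Set ℝ) (ptilde : ℝ → Fin n → ℝ) (hFam : NOSFamily Λ ptilde)
    (y : ℝ) (k : Fin n) (pk : ℝ) (w : ℝ) (hw : w ∈ Λ) :
    {ω | w ≤ NOSWelfare U Λ ptilde y k pk ω} =
      {ω | ∀ c, U ω c (y - ptilde w c) ≤ U ω k (y - pk)} := by
  ext ω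
  have hW := isGreatest_NOSWelfare hCont hR1 hFam y k pk ω
  refine ⟨fun hle c => ?_, fun h => hW.2 ⟨hw, h⟩⟩
  refine ((hMono ω c).monotone ?_).trans (hW.1.2 c)
  exact sub_le_sub_left (hFam.antitoneOn c hw hW.1.1 hle) y
end

section
/- (Corollary 1, marginal distribution of welfare.) Fix a family of nested opportunity sets (Λ, p̃) for income y, an alternative k ∈ C, a price p_k ∈ ℝ, and let W ω denote the NOS welfare measure of type ω at alternative k with price p_k. Then for every w ∈ Λ: μ {ω | w ≤ W ω} equals P_k(q, y) if p_k ≤ p̃ k w, and equals 0 otherwise, where q : C → ℝ is the price vector with q k = p_k and q c = p̃ c w for c ≠ k. -/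
open MeasureTheory
open scoped ENNReal BigOperators

/-- Virtual prices of a nested family are weakly decreasing in the index. -/
theorem NOSFamily.ptilde_le {n : ℕ} {Λ : Set ℝ} {ptilde : ℝ → Fin n → ℝ}
    (hFam : NOSFamily Λ ptilde) {l l' : ℝ} (hl : l ∈ Λ) (hl' : l' ∈ Λ) (h : l ≤ l')
    (c : Fin n) : ptilde l' c ≤ ptilde l c := by
  rcases h.eq_or_lt with rfl | h
  · exact le_rfl
  · exact (hFam.anti l hl l' hl' h).1 c

/-- The welfare measure is at least `w ∈ Λ` exactly when no alternative at the virtual prices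
of `w` is strictly better than the given option. -/
theorem le_NOSWelfare_iff {Ω : Type*} {n : ℕ} {U : Ω → Fin n → ℝ → ℝ} {ω : Ω}
    (hCont : ∀ c, Continuous (U ω c)) (hMono : ∀ c, Monotone (U ω c)) (hR1 : Reg1 U)
    {Λ : Set ℝ} {ptilde : ℝ → Fin n → ℝ} (hFam : NOSFamily Λ ptilde)
    (y : ℝ) (k : Fin n) (pk : ℝ) {w : ℝ} (hw : w ∈ Λ) :
    w ≤ NOSWelfare U Λ ptilde y k pk ω ↔
      ∀ c, U ω c (y - ptilde w c) ≤ U ω k (y - pk) := by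
  unfold NOSWelfare
  set S := {l | l ∈ Λ ∧ ∀ c, U ω c (y - ptilde l c) ≤ U ω k (y - pk)} with hS
  have hdown : ∀ l ∈ Λ, ∀ l' ∈ Λ, l ≤ l' → ∀ c,
      U ω c (y - ptilde l c) ≤ U ω c (y - ptilde l' c) := fun l hl l' hl' h c =>
    hMono c (sub_le_sub_left (hFam.ptilde_le hl hl' h c) y)
  have hne : S.Nonempty := by
    choose m hm using fun c => (hR1 ω k c (y - pk)).1
    choose l hlΛ hl using fun c => hFam.unbddAbove c (y - m c)
    obtain ⟨c₀, -, hc₀⟩ := Finset.exists_min_image Finset.univ l ⟨k, Finset.mem_univ k⟩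
    refine ⟨l c₀, hlΛ c₀, fun c => ?_⟩
    have h := hl c
    exact (hdown _ (hlΛ c₀) _ (hlΛ c) (hc₀ c (Finset.mem_univ c)) c).trans
      (hm c _ (by linarith)).le
  have hbdd : BddAbove S := by
    obtain ⟨c, hc⟩ := hFam.unbddBelow
    obtain ⟨m, hm⟩ := (hR1 ω k c (y - pk)).2
    obtain ⟨l₀, hl₀, h₀⟩ := hc (y - m)
    refine ⟨l₀, fun l hl => le_of_not_gt fun hlt => ?_⟩
    exact absurd ((hdown l₀ hl₀ l hl.1 hlt.le c).trans (hl.2 c))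
      (hm _ (by linarith)).not_ge
  have hclosed : IsClosed S := by
    have hc : ∀ c, IsClosed (Λ ∩ {l | U ω c (y - ptilde l c) ≤ U ω k (y - pk)}) := fun c =>
      ((hCont c).comp_continuousOn (continuousOn_const.sub
        (hFam.cont c))).preimage_isClosed_of_isClosed hFam.closed isClosed_Iic
    have hEq : S = ⋂ c, (Λ ∩ {l | U ω c (y - ptilde l c) ≤ U ω k (y - pk)}) := by
      ext l
      simp only [hS, Set.mem_iInter, Set.mem_inter_iff, Set.mem_ofPred_eq]
      exact ⟨fun h c => ⟨h.1, h.2 c⟩, fun h => ⟨(h k).1, fun c => (h c).2⟩⟩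
    exact hEq ▸ isClosed_iInter hc
  have hmem := hclosed.csSup_mem hne hbdd
  exact ⟨fun h c => (hdown w hw _ hmem.1 h c).trans (hmem.2 c),
    fun h => le_csSup hbdd ⟨hw, h⟩⟩

/-- An option at own price `pk` beats all alternatives at prices `r` exactly when `pk` does not
exceed its price in `r` and it is weakly optimal once its price is lowered to `pk`. -/
theorem forall_le_iff_weakOpt_update {Ω : Type*} {n : ℕ} {U : Ω → Fin n → ℝ → ℝ} {ω : Ω}
    {k : Fin n} (hMono : StrictMono (U ω k)) (r : Fin n → ℝ) (y pk : ℝ) :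
    (∀ c, U ω c (y - r c) ≤ U ω k (y - pk)) ↔
      pk ≤ r k ∧ WeakOpt U ω (Function.update r k pk) y k := by
  have hk : U ω k (y - r k) ≤ U ω k (y - pk) ↔ pk ≤ r k := by
    rw [hMono.le_iff_le, sub_le_sub_iff_left]
  simp only [WeakOpt, Function.update_self]
  constructor
  · refine fun h => ⟨hk.1 (h k), fun c => ?_⟩
    rcases eq_or_ne c k with rfl | hc
    · rw [Function.update_self]
    · rw [Function.update_of_ne hc]
      exact h c
  · rintro ⟨hle, h⟩ c
    rcases eq_or_ne c k with rfl | hc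
    · exact hk.2 hle
    · have := h c
      rwa [Function.update_of_ne hc] at this

/-- Corollary 1, marginal distribution of welfare. -/
theorem nos_welfare_marginal_distribution {Ω : Type*} [MeasurableSpace Ω] {n : ℕ} (hn : 0 < n)
    (μ : Measure Ω) [IsProbabilityMeasure μ]
    (U : Ω → Fin n → ℝ → ℝ)
    (hCont : ∀ ω c, Continuous (U ω c))
    (hMono : ∀ ω c, StrictMono (U ω c))
    (hR1 : Reg1 U)
    (Λ : Set ℝ) (ptilde : ℝ → Fin n → ℝ) (hFam : NOSFamily Λ ptilde)
    (y : ℝ) (k : Fin n) (pk : ℝ) (w : ℝ) (hw : w ∈ Λ) :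
    μ {ω | w ≤ NOSWelfare U Λ ptilde y k pk ω} =
      if pk ≤ ptilde w k
      then ChoiceProb μ U (Function.update (ptilde w) k pk) y k
      else 0 := by
  simp only [le_NOSWelfare_iff (hCont _) (fun c => (hMono _ c).monotone) hR1 hFam y k pk hw,
    forall_le_iff_weakOpt_update (hMono _ k)]
  split_ifs with h <;> simp [h, ChoiceProb]
end

section
/- (Corollary 1, marginal distribution of welfare in the optimal bundle.) Fix a family of nested opportunity sets (Λ, p̃) for income y and a price vector p : C → ℝ; for each k ∈ C let W_k ω denote the NOS welfare measure of type ω at alternative k with price p k. Then for every w ∈ Λ: μ {ω | ∃ k ∈ C, k is weakly optimal for ω at (p, y) and w ≤ W_k ω} = Σ_{k ∈ C} (if p k ≤ p̃ k w then P_k(min(p, p̃ w), y) else 0), where min(p, p̃ w) is the componentwise minimum of p and c ↦ p̃ c w. -/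
open MeasureTheory
open scoped ENNReal BigOperators

/-- The welfare measure is attained, so it is at least `w` exactly when the opportunity set
indexed by `w` offers nothing better than alternative `k` at its price. -/
theorem le_nosWelfare_iff {Ω : Type*} {n : ℕ} (hn : 0 < n) {U : Ω → Fin n → ℝ → ℝ}
    (hCont : ∀ ω c, Continuous (U ω c)) (hMono : ∀ ω c, StrictMono (U ω c)) (hR1 : Reg1 U)
    {Λ : Set ℝ} {ptilde : ℝ → Fin n → ℝ} (hFam : NOSFamily Λ ptilde)
    (y : ℝ) (k : Fin n) (pk : ℝ) (ω : Ω) {w : ℝ} (hw : w ∈ Λ) :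
    w ≤ NOSWelfare U Λ ptilde y k pk ω ↔
      ∀ c, U ω c (y - ptilde w c) ≤ U ω k (y - pk) := by
  have : Nonempty (Fin n) := ⟨⟨0, hn⟩⟩
  unfold NOSWelfare
  set S : Set ℝ := {l | l ∈ Λ ∧ ∀ c, U ω c (y - ptilde l c) ≤ U ω k (y - pk)} with hS
  have hanti : ∀ l ∈ Λ, ∀ l' ∈ Λ, l ≤ l' → ∀ c, ptilde l' c ≤ ptilde l c := by
    intro l hl l' hl' hll c
    rcases hll.eq_or_lt with rfl | h
    · exact le_rfl
    · exact (hFam.anti l hl l' hl' h).1 c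
  have hlower : ∀ l ∈ Λ, ∀ l' ∈ S, l ≤ l' → l ∈ S := fun l hl l' hl' hll =>
    ⟨hl, fun c => ((hMono ω c).monotone
      (sub_le_sub_left (hanti l hl l' hl'.1 hll c) y)).trans (hl'.2 c)⟩
  have hne : S.Nonempty := by
    choose m₀ hm₀ using fun c => (hR1 ω k c (y - pk)).1
    choose l hl hlm using fun c => hFam.unbddAbove c (y - m₀ c)
    obtain ⟨c₀, hc₀⟩ := Finite.exists_min l
    refine ⟨l c₀, hl c₀, fun c => (hm₀ c _ ?_).le⟩
    have := hanti _ (hl c₀) _ (hl c) (hc₀ c) c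
    linarith [hlm c]
  have hbdd : BddAbove S := by
    obtain ⟨c, hc⟩ := hFam.unbddBelow
    obtain ⟨m₁, hm₁⟩ := (hR1 ω k c (y - pk)).2
    obtain ⟨l, hl, hlm⟩ := hc (y - m₁)
    refine ⟨l, fun l' hl' => ?_⟩
    by_contra! h
    exact absurd ((hlower l hl l' hl' h.le).2 c) (not_le.2 (hm₁ _ (by linarith)))
  have hclosed : IsClosed S := by
    have : S = ⋂ c, Λ ∩ (fun l => U ω c (y - ptilde l c)) ⁻¹' Set.Iic (U ω k (y - pk)) := by
      rw [← Set.inter_iInter]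
      ext l
      simp [hS]
    rw [this]
    exact isClosed_iInter fun c => ((hCont ω c).comp_continuousOn
      (continuousOn_const.sub (hFam.cont c))).preimage_isClosed_of_isClosed
        hFam.closed isClosed_Iic
  exact ⟨fun h => (hlower w hw _ (hclosed.csSup_mem hne hbdd) h).2,
    fun h => le_csSup hbdd ⟨hw, h⟩⟩

/-- Being optimal at `p` and at least as good as everything offered at `q` amounts to being no
more expensive under `p` than under `q`, and optimal at the componentwise minimum. -/
theorem weakOpt_and_forall_le_iff {Ω : Type*} {n : ℕ} {U : Ω → Fin n → ℝ → ℝ}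
    (hMono : ∀ ω c, StrictMono (U ω c)) (p q : Fin n → ℝ) (y : ℝ) (k : Fin n) (ω : Ω) :
    (WeakOpt U ω p y k ∧ ∀ c, U ω c (y - q c) ≤ U ω k (y - p k)) ↔
      p k ≤ q k ∧ WeakOpt U ω (fun c => min (p c) (q c)) y k := by
  constructor
  · rintro ⟨hp, hq⟩
    have hk : p k ≤ q k := by
      have := (hMono ω k).le_iff_le.1 (hq k)
      linarith
    refine ⟨hk, fun c => ?_⟩
    simp only [min_eq_left hk]
    rcases min_choice (p c) (q c) with h | h <;> rw [h]
    exacts [hp c, hq c]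
  · rintro ⟨hk, h⟩
    simp only [WeakOpt, min_eq_left hk] at h
    exact ⟨fun c => ((hMono ω c).monotone (sub_le_sub_left (min_le_left _ _) y)).trans (h c),
      fun c => ((hMono ω c).monotone (sub_le_sub_left (min_le_right _ _) y)).trans (h c)⟩

/-- Corollary 1, marginal distribution of welfare in the optimal bundle. -/
theorem nos_welfare_optimal_marginal {Ω : Type*} [MeasurableSpace Ω] {n : ℕ} (hn : 0 < n)
    (μ : Measure Ω) [IsProbabilityMeasure μ]
    (U : Ω → Fin n → ℝ → ℝ)
    (hCont : ∀ ω c, Continuous (U ω c))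
    (hMono : ∀ ω c, StrictMono (U ω c))
    (hR1 : Reg1 U)
    (hR2 : Reg2 μ U)
    (Λ : Set ℝ) (ptilde : ℝ → Fin n → ℝ) (hFam : NOSFamily Λ ptilde)
    (y : ℝ) (p : Fin n → ℝ) (w : ℝ) (hw : w ∈ Λ)
    (hMeas : ∀ i : Fin n,
      MeasurableSet {ω | WeakOpt U ω p y i ∧ w ≤ NOSWelfare U Λ ptilde y i (p i) ω}) :
    μ {ω | ∃ k : Fin n, WeakOpt U ω p y k ∧ w ≤ NOSWelfare U Λ ptilde y k (p k) ω} =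
      ∑ k : Fin n,
        (if p k ≤ ptilde w k
         then ChoiceProb μ U (fun c => min (p c) (ptilde w c)) y k
         else 0) := by
  rw [Set.ofPred_exists, measure_iUnion₀ ?_ fun k => (hMeas k).nullMeasurableSet,
    tsum_fintype]
  · refine Finset.sum_congr rfl fun k _ => ?_
    simp only [le_nosWelfare_iff hn hCont hMono hR1 hFam y _ _ _ hw,
      weakOpt_and_forall_le_iff hMono]
    split_ifs with hk <;> simp [hk, ChoiceProb]
  · intro i j hij
    exact measure_mono_null (fun ω h => le_antisymm (h.2.1 i) (h.1.1 j)) (hR2 p y i j hij)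
end

section
/- (Corollary 2, joint distribution for the MMU.) Fix reference prices r : C → ℝ, income y ∈ ℝ, an alternative k ∈ C and a price p_k ∈ ℝ, and let W ω be the money-metric utility of type ω at alternative k with price p_k and reference prices r. Then for every w ∈ ℝ, every price vector p' : C → ℝ and every j ∈ C: μ {ω | w ≤ W ω and j is weakly optimal for ω at (p', y)} equals P_{j,k}(p', q, y) if p_k ≤ y − w + r k, and equals 0 otherwise, where q : C → ℝ is the price vector with q k = p_k and q c = y − w + r c for c ≠ k. -/
open MeasureTheory
open scoped ENNReal BigOperators

/-- The MMU is at least `w` iff every alternative, at `w` net of its reference price,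
is weakly worse than the alternative being evaluated. -/
theorem le_MMU_iff {Ω : Type*} {n : ℕ} {U : Ω → Fin n → ℝ → ℝ}
    (hCont : ∀ ω c, Continuous (U ω c)) (hMono : ∀ ω c, StrictMono (U ω c)) (hR1 : Reg1 U)
    (r : Fin n → ℝ) (y : ℝ) (k : Fin n) (pk w : ℝ) (ω : Ω) :
    w ≤ MMU U r y k pk ω ↔ ∀ c, U ω c (w - r c) ≤ U ω k (y - pk) := by
  have bdd : BddAbove {l : ℝ | ∀ c, U ω c (l - r c) ≤ U ω k (y - pk)} :=
    ⟨y - pk + r k, fun l hl => by linarith [(hMono ω k).le_iff_le.1 (hl k)]⟩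
  have closed : IsClosed {l : ℝ | ∀ c, U ω c (l - r c) ≤ U ω k (y - pk)} := by
    simp only [Set.ofPred_forall]
    exact isClosed_iInter fun c =>
      isClosed_le ((hCont ω c).comp (continuous_id.sub continuous_const)) continuous_const
  have nonempty : {l : ℝ | ∀ c, U ω c (l - r c) ≤ U ω k (y - pk)}.Nonempty := by
    choose m hm using fun c => (hR1 ω k c (y - pk)).1
    obtain ⟨b, hb⟩ := (Set.finite_range fun c => m c + r c).bddBelow
    exact ⟨b, fun c => (hm c _ (by linarith [hb (Set.mem_range_self c)])).le⟩
  refine ⟨fun h c => ?_, fun h => le_csSup bdd h⟩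
  exact ((hMono ω c).monotone (sub_le_sub_right h (r c))).trans
    (closed.csSup_mem nonempty bdd c)

/-- Weak optimality of `k` when every other alternative is priced at its reference price shifted
by `y - w`. -/
theorem weakOpt_update_iff {Ω : Type*} {n : ℕ} (U : Ω → Fin n → ℝ → ℝ)
    (r : Fin n → ℝ) (y : ℝ) (k : Fin n) (pk w : ℝ) (ω : Ω) :
    WeakOpt U ω (Function.update (fun c => y - w + r c) k pk) y k ↔
      ∀ c ≠ k, U ω c (w - r c) ≤ U ω k (y - pk) := by
  refine forall_congr' fun c => ?_
  rcases eq_or_ne c k with rfl | hc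
  · simp
  · have h : y - (y - w + r c) = w - r c := by ring
    simp [hc, h]

/-- Corollary 2, joint distribution for the MMU. -/
theorem mmu_joint_distribution {Ω : Type*} [MeasurableSpace Ω] {n : ℕ} (hn : 0 < n)
    (μ : Measure Ω) [IsProbabilityMeasure μ]
    (U : Ω → Fin n → ℝ → ℝ)
    (hCont : ∀ ω c, Continuous (U ω c))
    (hMono : ∀ ω c, StrictMono (U ω c))
    (hR1 : Reg1 U)
    (r : Fin n → ℝ) (y : ℝ) (k : Fin n) (pk : ℝ)
    (w : ℝ) (p' : Fin n → ℝ) (j : Fin n) :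
    μ {ω | w ≤ MMU U r y k pk ω ∧ WeakOpt U ω p' y j} =
      if pk ≤ y - w + r k
      then TransProb μ U p' (Function.update (fun c => y - w + r c) k pk) y j k
      else 0 := by
  simp only [le_MMU_iff hCont hMono hR1]
  split_ifs with hp
  · rw [TransProb]
    congr 1
    ext ω
    simp only [Set.mem_ofPred_eq, weakOpt_update_iff]
    refine ⟨fun h => ⟨h.2, fun c _ => h.1 c⟩, fun h => ⟨fun c => ?_, h.1⟩⟩
    rcases eq_or_ne c k with rfl | hc
    · exact (hMono ω c).monotone (by linarith)
    · exact h.2 c hc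
  · have : {ω | (∀ c, U ω c (w - r c) ≤ U ω k (y - pk)) ∧ WeakOpt U ω p' y j} = ∅ :=
      Set.eq_empty_of_forall_notMem fun ω h =>
        hp (by linarith [(hMono ω k).le_iff_le.1 (h.1 k)])
    rw [this, measure_empty]
end

section
/- (Corollary 2, MMU at actual prices.) Fix income y ∈ ℝ, a price vector p' : C → ℝ and an alternative k ∈ C, and let W ω be the money-metric utility of type ω at alternative k with price p' k and reference prices p'. Then for every w ∈ ℝ: μ {ω | w ≤ W ω and k is weakly optimal for ω at (p', y)} equals P_k(p', y) if w ≤ y, and equals 0 otherwise. -/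
open MeasureTheory
open scoped ENNReal BigOperators

/-- At a weakly optimal alternative, money-metric utility at the actual prices is income. -/
theorem WeakOpt.mmu_eq {Ω : Type*} {n : ℕ} {U : Ω → Fin n → ℝ → ℝ} {ω : Ω}
    {p : Fin n → ℝ} {y : ℝ} {k : Fin n} (hMono : StrictMono (U ω k))
    (h : WeakOpt U ω p y k) : MMU U p y k (p k) ω = y := by
  refine IsGreatest.csSup_eq ⟨h, fun l hl => ?_⟩
  have := hMono.le_iff_le.mp (hl k)
  linarith

/-- Corollary 2, MMU at actual prices. -/
theorem mmu_actual_prices {Ω : Type*} [MeasurableSpace Ω] {n : ℕ} (hn : 0 < n)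
    (μ : Measure Ω) [IsProbabilityMeasure μ]
    (U : Ω → Fin n → ℝ → ℝ)
    (hCont : ∀ ω c, Continuous (U ω c))
    (hMono : ∀ ω c, StrictMono (U ω c))
    (hR1 : Reg1 U)
    (y : ℝ) (p' : Fin n → ℝ) (k : Fin n) (w : ℝ) :
    μ {ω | w ≤ MMU U p' y k (p' k) ω ∧ WeakOpt U ω p' y k} =
      if w ≤ y then ChoiceProb μ U p' y k else 0 := by
  have hset : {ω | w ≤ MMU U p' y k (p' k) ω ∧ WeakOpt U ω p' y k} =
      {ω | w ≤ y ∧ WeakOpt U ω p' y k} := by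
    ext ω
    exact and_congr_left fun h => by rw [h.mmu_eq (hMono ω k)]
  rw [hset]
  split_ifs with hw <;> simp [hw, ChoiceProb]
end

section
/- (Lemma 2, characterisation of the compensating variation.) Let p, p' : C → ℝ be price vectors, y ∈ ℝ an income, and CV : Ω → ℝ a compensating variation. Then for all i, j ∈ C and z ∈ ℝ: {ω | CV ω ≤ z and i is weakly optimal for ω at (p, y) and j is weakly optimal for ω at (p', y)} = {ω | (∀ c ∈ C, U ω i (y − p i) ≥ U ω c (y − p' c − z)) and i is weakly optimal for ω at (p, y) and j is weakly optimal for ω at (p', y)}. -/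
open MeasureTheory
open scoped ENNReal BigOperators

/-- The utility of a weakly optimal alternative is the maximal utility. -/
theorem WeakOpt.iSup_eq {Ω : Type*} {n : ℕ} {U : Ω → Fin n → ℝ → ℝ} {ω : Ω}
    {p : Fin n → ℝ} {y : ℝ} {i : Fin n} (h : WeakOpt U ω p y i) :
    (⨆ c, U ω c (y - p c)) = U ω i (y - p i) :=
  have : Nonempty (Fin n) := ⟨i⟩
  le_antisymm (ciSup_le h) (le_ciSup (f := fun c => U ω c (y - p c)) (Finite.bddAbove_range _) i)

/-- For strictly increasing utilities, paying `z` keeps every utility below the maximal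
utility after paying `t` exactly if `t ≤ z`. -/
theorem le_iff_forall_le_iSup_sub {n : ℕ} [Nonempty (Fin n)] {u : Fin n → ℝ → ℝ}
    (hu : ∀ c, StrictMono (u c)) (m : Fin n → ℝ) (t z : ℝ) :
    t ≤ z ↔ ∀ c, u c (m c - z) ≤ ⨆ c, u c (m c - t) := by
  constructor
  · intro h c
    exact ((hu c).monotone (by linarith)).trans
      (le_ciSup (f := fun c => u c (m c - t)) (Finite.bddAbove_range _) c)
  · intro h
    obtain ⟨c, hc⟩ := exists_eq_ciSup_of_finite (f := fun c => u c (m c - t))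
    have hle := (h c).trans_eq hc.symm
    linarith [(hu c).le_iff_le.mp hle]

/-- Lemma 2: characterisation of the compensating variation. -/
theorem cv_characterisation {Ω : Type*} [MeasurableSpace Ω] {n : ℕ} (hn : 0 < n)
    (μ : Measure Ω) [IsProbabilityMeasure μ]
    (U : Ω → Fin n → ℝ → ℝ)
    (hMono : ∀ ω c, StrictMono (U ω c))
    (p p' : Fin n → ℝ) (y : ℝ) (CV : Ω → ℝ) (hCV : IsCV U p p' y CV)
    (i j : Fin n) (z : ℝ) :
    {ω | CV ω ≤ z ∧ WeakOpt U ω p y i ∧ WeakOpt U ω p' y j} =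
      {ω | (∀ c, U ω c (y - p' c - z) ≤ U ω i (y - p i)) ∧
           WeakOpt U ω p y i ∧ WeakOpt U ω p' y j} := by
  ext ω
  refine and_congr_left fun ⟨hi, _⟩ => ?_
  have : Nonempty (Fin n) := ⟨i⟩
  rw [← hi.iSup_eq, hCV ω]
  exact le_iff_forall_le_iSup_sub (hMono ω) (fun c => y - p' c) (CV ω) z
end

section
/- (Theorem 3, joint distribution of the compensating variation and choices.) Let p, p' : C → ℝ be price vectors, y ∈ ℝ an income, and CV : Ω → ℝ a compensating variation. Then for all i, j ∈ C and z ∈ ℝ: μ {ω | CV ω ≤ z and i is weakly optimal for ω at (p, y) and j is weakly optimal for ω at (p', y)} equals P_{i,j}(min(p, p' + z), p', y) if p i ≤ p' i + z, and equals 0 otherwise, where min denotes the componentwise minimum and p' + z the vector with components p' c + z. -/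
open MeasureTheory
open scoped ENNReal BigOperators

/-- The compensating variation is at most `z` iff, at prices `p' + z`, no alternative is
better than the best one at the initial prices `p`. -/
theorem IsCV.le_iff {Ω : Type*} {n : ℕ} {U : Ω → Fin n → ℝ → ℝ}
    (hMono : ∀ ω c, StrictMono (U ω c)) {p p' : Fin n → ℝ} {y : ℝ} {CV : Ω → ℝ}
    (hCV : IsCV U p p' y CV) {ω : Ω} {i : Fin n} (hi : WeakOpt U ω p y i) (z : ℝ) :
    CV ω ≤ z ↔ ∀ c, U ω c (y - (p' c + z)) ≤ U ω i (y - p i) := by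
  have : Nonempty (Fin n) := ⟨i⟩
  have hsup : ⨆ c, U ω c (y - p' c - CV ω) = U ω i (y - p i) :=
    (hCV ω).symm.trans <| le_antisymm (ciSup_le hi) <|
      le_ciSup (f := fun c => U ω c (y - p c)) (Set.finite_range _).bddAbove i
  constructor
  · intro h c
    calc U ω c (y - (p' c + z)) ≤ U ω c (y - p' c - CV ω) := (hMono ω c).monotone (by linarith)
      _ ≤ ⨆ c, U ω c (y - p' c - CV ω) :=
        le_ciSup (f := fun c => U ω c (y - p' c - CV ω)) (Set.finite_range _).bddAbove c
      _ = U ω i (y - p i) := hsup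
  · intro h
    by_contra! hz
    obtain ⟨c, hc⟩ := exists_eq_ciSup_of_finite (f := fun c => U ω c (y - p' c - CV ω))
    have hlt : U ω c (y - p' c - CV ω) < U ω c (y - (p' c + z)) := hMono ω c (by linarith)
    exact (hlt.trans_le (h c)).ne (hc.trans hsup)

/-- An alternative whose price `p i` is at most `q i` is weakly optimal at the componentwise
minimum of `p` and `q` iff it is weakly optimal at `p` and no alternative at prices `q`
is better. -/
theorem weakOpt_min_iff {Ω : Type*} {n : ℕ} {U : Ω → Fin n → ℝ → ℝ} {ω : Ω}
    (hMono : ∀ c, StrictMono (U ω c)) {p q : Fin n → ℝ} {i : Fin n} (hpq : p i ≤ q i) (y : ℝ) :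
    WeakOpt U ω (fun c => min (p c) (q c)) y i ↔
      WeakOpt U ω p y i ∧ ∀ c, U ω c (y - q c) ≤ U ω i (y - p i) := by
  simp only [WeakOpt, min_eq_left hpq, ← forall_and]
  refine forall_congr' fun c => ?_
  rw [← max_sub_sub_left, (hMono c).monotone.map_max, max_le_iff]

/-- Theorem 3: joint distribution of the compensating variation
and the choices before and after the price change. -/
theorem cv_joint_distribution {Ω : Type*} [MeasurableSpace Ω] {n : ℕ} (hn : 0 < n)
    (μ : Measure Ω) [IsProbabilityMeasure μ]
    (U : Ω → Fin n → ℝ → ℝ)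
    (hMono : ∀ ω c, StrictMono (U ω c))
    (p p' : Fin n → ℝ) (y : ℝ) (CV : Ω → ℝ) (hCV : IsCV U p p' y CV)
    (i j : Fin n) (z : ℝ) :
    μ {ω | CV ω ≤ z ∧ WeakOpt U ω p y i ∧ WeakOpt U ω p' y j} =
      if p i ≤ p' i + z
      then TransProb μ U (fun c => min (p c) (p' c + z)) p' y i j
      else 0 := by
  split_ifs with hz
  · refine congrArg μ (Set.ext fun ω => ?_)
    simp only [Set.mem_ofPred_eq]
    rw [weakOpt_min_iff (hMono ω) (q := fun c => p' c + z) hz, ← and_assoc]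
    refine and_congr_left' ?_
    rw [and_comm]
    exact and_congr_right fun hi => hCV.le_iff hMono hi z
  · convert measure_empty (μ := μ)
    refine Set.eq_empty_of_forall_notMem fun ω ⟨h, hi, _⟩ => ?_
    exact ((hCV.le_iff hMono hi z).1 h i).not_gt (hMono ω i (by linarith))
end

section
/- (Corollary 3, marginal distribution of the compensating variation.) Let p, p' : C → ℝ be price vectors, y ∈ ℝ an income, and CV : Ω → ℝ a compensating variation. Then for every z ∈ ℝ: μ {ω | CV ω ≤ z} = Σ_{i ∈ C} (if p i ≤ p' i + z then P_i(min(p, p' + z), y) else 0), where min denotes the componentwise minimum and p' + z the vector with components p' c + z. -/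
open MeasureTheory
open scoped ENNReal BigOperators

/-- At a compensating variation, `CV ω ≤ z` together with optimality of `i` at `p` amounts to
`i` keeping its price and being optimal at the componentwise minimum of `p` and `p' + z`. -/
theorem cv_le_and_weakOpt_iff {Ω : Type*} {n : ℕ} {U : Ω → Fin n → ℝ → ℝ}
    (hMono : ∀ ω c, StrictMono (U ω c)) {p p' : Fin n → ℝ} {y : ℝ} {CV : Ω → ℝ}
    (hCV : IsCV U p p' y CV) (z : ℝ) (ω : Ω) (i : Fin n) :
    (CV ω ≤ z ∧ WeakOpt U ω p y i) ↔
      (p i ≤ p' i + z ∧ WeakOpt U ω (fun c => min (p c) (p' c + z)) y i) := by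
  have : Nonempty (Fin n) := ⟨i⟩
  constructor
  · rintro ⟨hz, hi⟩
    have key : ∀ c, U ω c (y - (p' c + z)) ≤ U ω i (y - p i) := fun c =>
      calc U ω c (y - (p' c + z)) ≤ U ω c (y - p' c - CV ω) :=
            (hMono ω c).monotone (by linarith)
        _ ≤ ⨆ c, U ω c (y - p' c - CV ω) :=
            le_ciSup (f := fun c => U ω c (y - p' c - CV ω)) (Set.finite_range _).bddAbove c
        _ = ⨆ c, U ω c (y - p c) := (hCV ω).symm
        _ ≤ U ω i (y - p i) := ciSup_le hi
    have hpi : p i ≤ p' i + z := by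
      have := (hMono ω i).le_iff_le.1 (key i)
      linarith
    refine ⟨hpi, fun c => ?_⟩
    simp only [min_eq_left hpi]
    rcases min_choice (p c) (p' c + z) with h | h <;> rw [h]
    exacts [hi c, key c]
  · rintro ⟨hpi, hi⟩
    simp only [WeakOpt, min_eq_left hpi] at hi
    refine ⟨?_, fun c => ((hMono ω c).monotone ?_).trans (hi c)⟩
    · by_contra! hlt
      obtain ⟨c, hc⟩ := exists_eq_ciSup_of_finite (f := fun c => U ω c (y - p' c - CV ω))
      have h₁ : U ω c (y - p' c - CV ω) < U ω c (y - min (p c) (p' c + z)) :=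
        hMono ω c (by linarith [min_le_right (p c) (p' c + z)])
      have h₂ : U ω i (y - p i) ≤ ⨆ c, U ω c (y - p c) :=
        le_ciSup (f := fun c => U ω c (y - p c)) (Set.finite_range _).bddAbove i
      have h₃ := hCV ω
      have h₄ := hi c
      linarith
    · linarith [min_le_left (p c) (p' c + z)]

/-- Some alternative is weakly optimal. -/
theorem exists_weakOpt {Ω : Type*} {n : ℕ} (hn : 0 < n) (U : Ω → Fin n → ℝ → ℝ) (ω : Ω)
    (p : Fin n → ℝ) (y : ℝ) : ∃ i, WeakOpt U ω p y i := by
  have : Nonempty (Fin n) := ⟨⟨0, hn⟩⟩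
  exact Finite.exists_max fun c => U ω c (y - p c)

/-- Corollary 3, marginal distribution of the CV. -/
theorem cv_marginal_distribution {Ω : Type*} [MeasurableSpace Ω] {n : ℕ} (hn : 0 < n)
    (μ : Measure Ω) [IsProbabilityMeasure μ]
    (U : Ω → Fin n → ℝ → ℝ)
    (hMono : ∀ ω c, StrictMono (U ω c))
    (hR2 : Reg2 μ U)
    (p p' : Fin n → ℝ) (y : ℝ) (CV : Ω → ℝ) (hCV : IsCV U p p' y CV)
    (z : ℝ)
    (hMeas : ∀ i : Fin n, MeasurableSet {ω | CV ω ≤ z ∧ WeakOpt U ω p y i}) :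
    μ {ω | CV ω ≤ z} =
      ∑ i : Fin n,
        (if p i ≤ p' i + z
         then ChoiceProb μ U (fun c => min (p c) (p' c + z)) y i
         else 0) := by
  have hUnion : {ω | CV ω ≤ z} = ⋃ i, {ω | CV ω ≤ z ∧ WeakOpt U ω p y i} := by
    ext ω
    simp [exists_weakOpt hn U ω p y]
  have hDisj : Pairwise (Function.onFun (AEDisjoint μ)
      fun i => {ω | CV ω ≤ z ∧ WeakOpt U ω p y i}) := fun i j hij =>
    measure_mono_null (fun _ h => le_antisymm (h.2.2 i) (h.1.2 j)) (hR2 p y i j hij)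
  rw [hUnion, measure_iUnion₀ hDisj fun i => (hMeas i).nullMeasurableSet, tsum_fintype]
  refine Finset.sum_congr rfl fun i _ => ?_
  simp only [cv_le_and_weakOpt_iff hMono hCV]
  split_ifs with h <;> simp [h, ChoiceProb]
end

section
/- (Proposition 3, revealed-preference lower bound in the no-transition case.) For every i ∈ C, all price vectors p, p' : C → ℝ, and every income y ∈ ℝ: P_{i,i}(p, p', y) ≥ P_i(q, y), where q : C → ℝ is the price vector with q i = max(p i, p' i) and q c = min(p c, p' c) for all c ≠ i. -/
open MeasureTheory
open scoped ENNReal BigOperators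

/-- Weak optimality of `i` is preserved when the price of `i` weakly falls and
all other prices weakly rise. -/
theorem WeakOpt.of_price_le {Ω : Type*} {n : ℕ} {U : Ω → Fin n → ℝ → ℝ} {ω : Ω}
    (hMono : ∀ c, Monotone (U ω c)) {q p : Fin n → ℝ} {y : ℝ} {i : Fin n}
    (hi : p i ≤ q i) (hne : ∀ c, c ≠ i → q c ≤ p c) (h : WeakOpt U ω q y i) :
    WeakOpt U ω p y i := by
  intro c
  obtain rfl | hc := eq_or_ne c i
  · exact le_rfl
  · exact ((hMono c (sub_le_sub_left (hne c hc) y)).trans (h c)).trans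
      (hMono i (sub_le_sub_left hi y))

/-- Proposition 3, revealed-preference lower bound in the
no-transition case. -/
theorem transition_rp_lower_bound {Ω : Type*} [MeasurableSpace Ω] {n : ℕ} (hn : 0 < n)
    (μ : Measure Ω) [IsProbabilityMeasure μ]
    (U : Ω → Fin n → ℝ → ℝ)
    (hMono : ∀ ω c, StrictMono (U ω c))
    (i : Fin n) (p p' : Fin n → ℝ) (y : ℝ) :
    ChoiceProb μ U
        (Function.update (fun c => min (p c) (p' c)) i (max (p i) (p' i))) y i ≤
      TransProb μ U p p' y i i := by
  refine measure_mono fun ω hω => ⟨?_, ?_⟩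
  all_goals
    refine WeakOpt.of_price_le (fun c => (hMono ω c).monotone) ?_ ?_ hω
    · simp
    · intro c hc
      simp [hc]
end

section
/- (Proposition 3, irrational transitions have probability zero.) Let i, j ∈ C with i ≠ j, let p, p' : C → ℝ be price vectors with p' i ≤ p i and p j ≤ p' j, and let y ∈ ℝ. Then P_{i,j}(p, p', y) = 0. -/
open MeasureTheory
open scoped ENNReal BigOperators

/-- Proposition 3, irrational transitions have probability zero. -/
theorem transition_irrational_zero {Ω : Type*} [MeasurableSpace Ω] {n : ℕ} (hn : 0 < n)
    (μ : Measure Ω) [IsProbabilityMeasure μ]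
    (U : Ω → Fin n → ℝ → ℝ)
    (hMono : ∀ ω c, StrictMono (U ω c))
    (hR2 : Reg2 μ U)
    (i j : Fin n) (hij : i ≠ j) (p p' : Fin n → ℝ)
    (hpi : p' i ≤ p i) (hpj : p j ≤ p' j) (y : ℝ) :
    TransProb μ U p p' y i j = 0 := by
  refine measure_mono_null (fun ω hω => ?_) (hR2 p y i j hij)
  have hi : U ω i (y - p i) ≤ U ω i (y - p' i) := (hMono ω i).monotone (by linarith)
  have hj : U ω j (y - p' j) ≤ U ω j (y - p j) := (hMono ω j).monotone (by linarith)
  exact le_antisymm (hi.trans ((hω.2 i).trans hj)) (hω.1 j)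
end
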